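/- Let m > 2 be an integer and let G be a connected strongly regular graph with parameters (m², 3(m−1), m, 6). Then the eigenvalues of the distance matrix D of G are exactly 1, 1−m and m(2m−3)+1, with multiplicities m²−3m+2, 3m−3 and 1 respectively. -/

import Mathlib

open Matrix Finset

/-- The distance matrix of a graph, as a real matrix. -/
noncomputable def distMatrix {V : Type*} [Fintype V] (G : SimpleGraph V) : Matrix V V ℝ :=
  Matrix.of fun u v => (G.dist u v : ℝ)

theorem aux_trace_sq {V : Type*} [Fintype V] [DecidableEq V] (D : Matrix V V ℝ)
    (hD : D.IsHermitian) : (D * D).trace = ∑ i, hD.eigenvalues i ^ 2 := by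
  have h := hD.spectral_theorem
  rw [Unitary.conjStarAlgAut_apply] at h
  set U : Matrix V V ℝ := (hD.eigenvectorUnitary : Matrix V V ℝ) with hU
  have hUU : star U * U = 1 := Unitary.coe_star_mul_self hD.eigenvectorUnitary
  set L : Matrix V V ℝ := diagonal (RCLike.ofReal ∘ hD.eigenvalues) with hL
  have h1 : D * D = U * (L * L) * star U := by
    calc D * D = (U * L * star U) * (U * L * star U) := by
          conv_lhs => rw [h]
      _ = U * L * (star U * U) * L * star U := by simp only [Matrix.mul_assoc]
      _ = _ := by rw [hUU]; simp only [Matrix.mul_assoc, Matrix.one_mul]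
  rw [h1, Matrix.trace_mul_comm, ← Matrix.mul_assoc, hUU, Matrix.one_mul, hL,
    diagonal_mul_diagonal, trace_diagonal]
  simp [sq]

theorem aux_root {V : Type*} [Fintype V] [DecidableEq V] (D : Matrix V V ℝ)
    (hD : D.IsHermitian) (p q r : ℝ) (h : D * (D * D) = p • (D * D) + q • D + r • 1) (i : V) :
    hD.eigenvalues i ^ 3 =
      p * hD.eigenvalues i ^ 2 + q * hD.eigenvalues i + r := by
  have hv := hD.mulVec_eigenvectorBasis i
  set v : V → ℝ := (hD.eigenvectorBasis i).ofLp with hvd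
  have hne : v ≠ 0 := by
    intro h0
    apply hD.eigenvectorBasis.orthonormal.ne_zero i
    ext j
    exact congrFun h0 j
  set x := hD.eigenvalues i
  have := congrArg (fun M => M *ᵥ v) h
  simp only [← Matrix.mulVec_mulVec, Matrix.add_mulVec, Matrix.smul_mulVec, hv,
    Matrix.mulVec_smul, Matrix.one_mulVec] at this
  obtain ⟨j, hj⟩ := Function.ne_iff.mp hne
  have h2 := congrFun this j
  simp only [Pi.add_apply, Pi.smul_apply, smul_eq_mul, Pi.zero_apply] at h2 hj
  apply mul_right_cancel₀ hj
  linear_combination h2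

theorem aux_alg {V : Type*} [Fintype V] [DecidableEq V] (A J : Matrix V V ℝ) (m : ℝ)
    (hJJ : J * J = (m ^ 2) • J) (hAJ : A * J = (3 * (m - 1)) • J)
    (hJA : J * A = (3 * (m - 1)) • J)
    (hAA : A * A = (3 * (m - 1)) • (1 : Matrix V V ℝ) + m • A + (6 : ℝ) • (J - 1 - A))
    (D : Matrix V V ℝ) (hDd : D = (2 : ℝ) • J - (2 : ℝ) • 1 - A) :
    D * J = (m * (2 * m - 3) + 1) • J ∧
    D * D = (2 - m) • D + (m - 1) • 1 + (4 * m ^ 2 - 10 * m + 6) • J := by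
  subst hDd
  constructor
  · simp only [sub_mul, smul_mul_assoc, hJJ, hAJ, one_mul]
    module
  · simp only [sub_mul, mul_sub, smul_mul_assoc, mul_smul_comm, hJJ, hAJ, hJA, hAA, one_mul, mul_one]
    module

theorem aux_dist {V : Type*} [Fintype V] [DecidableEq V]
    (G : SimpleGraph V) [DecidableRel G.Adj] (n k l : ℕ)
    (hsrg : G.IsSRGWith n k l 6) :
    distMatrix G = (2 : ℝ) • (Matrix.of fun _ _ => (1 : ℝ)) - (2 : ℝ) • 1 - G.adjMatrix ℝ := by
  ext u v
  simp only [distMatrix, Matrix.of_apply, Matrix.sub_apply, Matrix.smul_apply,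
    SimpleGraph.adjMatrix_apply, smul_eq_mul]
  by_cases huv : u = v
  · subst huv; simp
  · by_cases ha : G.Adj u v
    · rw [SimpleGraph.dist_eq_one_iff_adj.mpr ha]
      simp [huv, ha]; norm_num
    · have hc := hsrg.of_not_adj huv ha
      have hne : (G.commonNeighbors u v).Nonempty := by
        rw [Set.nonempty_iff_ne_empty]
        intro h0
        rw [Fintype.card_eq_zero_iff.mpr (Set.isEmpty_coe_sort.mpr h0)] at hc
        omega
      have h2 : G.edist u v = 2 := SimpleGraph.edist_eq_two_iff.mpr ⟨huv, ha, hne⟩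
      have h3 : G.dist u v = 2 := by rw [SimpleGraph.dist, h2]; rfl
      simp [huv, ha, h3]

/-- For `m > 2` and a connected strongly regular graph with parameters
`(m², 3(m-1), m, 6)`, the eigenvalues of the distance matrix are exactly `1`, `1 - m` and
`m(2m-3) + 1`, with multiplicities `m² - 3m + 2`, `3m - 3` and `1` respectively. -/
theorem srg_m_sq_distMatrix_eigenvalues {V : Type*} [Fintype V] [DecidableEq V]
    (G : SimpleGraph V) [DecidableRel G.Adj] (m : ℕ) (hm : 2 < m)
    (hsrg : G.IsSRGWith (m ^ 2) (3 * (m - 1)) m 6) (hconn : G.Connected)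
    (hD : (distMatrix G).IsHermitian) :
    (∀ i, hD.eigenvalues i = 1 ∨
          hD.eigenvalues i = 1 - (m : ℝ) ∨
          hD.eigenvalues i = (m : ℝ) * (2 * m - 3) + 1) ∧
    (Finset.univ.filter fun i => hD.eigenvalues i = 1).card = m ^ 2 - 3 * m + 2 ∧
    (Finset.univ.filter fun i => hD.eigenvalues i = 1 - (m : ℝ)).card = 3 * m - 3 ∧
    (Finset.univ.filter fun i => hD.eigenvalues i = (m : ℝ) * (2 * m - 3) + 1).card = 1 := by

  classical
  set J : Matrix V V ℝ := Matrix.of fun _ _ => (1 : ℝ) with hJ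
  set A : Matrix V V ℝ := G.adjMatrix ℝ with hA
  have hcard : (Fintype.card V : ℝ) = (m : ℝ) ^ 2 := by rw [hsrg.card]; push_cast; rfl
  have hk : ((3 * (m - 1) : ℕ) : ℝ) = 3 * ((m : ℝ) - 1) := by
    rw [Nat.cast_mul, Nat.cast_sub (by omega)]; norm_num
  have hJJ : J * J = ((m : ℝ) ^ 2) • J := by
    ext u v
    simp [hJ, Matrix.mul_apply, hcard]
  have hAJ : A * J = (3 * ((m : ℝ) - 1)) • J := by
    ext u v
    rw [hA, SimpleGraph.adjMatrix_mul_apply]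
    simp [hJ, hsrg.regular.degree_eq u, ← hk]
  have hJA : J * A = (3 * ((m : ℝ) - 1)) • J := by
    ext u v
    rw [hA, SimpleGraph.mul_adjMatrix_apply]
    simp [hJ, hsrg.regular.degree_eq v, ← hk]
  have hAA : A * A = (3 * ((m : ℝ) - 1)) • (1 : Matrix V V ℝ) + (m : ℝ) • A
      + (6 : ℝ) • (J - 1 - A) := by
    have h := hsrg.matrix_eq (α := ℝ)
    have hC : Gᶜ.adjMatrix ℝ = J - 1 - A := by
      ext u v
      simp only [hJ, hA, Matrix.sub_apply, Matrix.of_apply, SimpleGraph.adjMatrix_apply,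
        SimpleGraph.compl_adj]
      by_cases huv : u = v
      · subst huv; simp
      · by_cases ha : G.Adj u v <;> simp [huv, ha]
    rw [hC, ← hA, sq] at h
    rw [h, ← hk]
    simp only [← Nat.cast_smul_eq_nsmul ℝ]
    norm_num
  obtain ⟨hDJ, hDD⟩ := aux_alg A J m hJJ hAJ hJA hAA (distMatrix G) (aux_dist G _ _ _ hsrg)
  have hmR : (2 : ℝ) < m := by exact_mod_cast hm
  have hroot := aux_root (distMatrix G) hD (2 - m + ((m : ℝ) * (2 * m - 3) + 1))
    ((m - 1) - ((m : ℝ) * (2 * m - 3) + 1) * (2 - m))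
    (-((m : ℝ) * (2 * m - 3) + 1) * (m - 1)) (by
      have : distMatrix G * (distMatrix G * distMatrix G) = (2 - (m : ℝ)) • (distMatrix G * distMatrix G)
          + ((m : ℝ) - 1) • distMatrix G
          + ((4 * (m : ℝ) ^ 2 - 10 * m + 6) * ((m : ℝ) * (2 * m - 3) + 1)) • J := by
        conv_lhs => rw [hDD]
        simp only [mul_add, mul_smul_comm, hDJ, mul_one, smul_smul]
      rw [this, hDD]
      module)
  have htri : ∀ i, hD.eigenvalues i = 1 ∨
          hD.eigenvalues i = 1 - (m : ℝ) ∨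
          hD.eigenvalues i = (m : ℝ) * (2 * m - 3) + 1 := by
    intro i
    have h := hroot i
    set x := hD.eigenvalues i
    have h2 : (x - 1) * ((x - (1 - m)) * (x - (m * (2 * m - 3) + 1))) = 0 := by
      linear_combination h
    rcases mul_eq_zero.mp h2 with h | h
    · left; linarith
    · rcases mul_eq_zero.mp h with h | h
      · right; left; linarith
      · right; right; linarith
  have htrD : (distMatrix G).trace = 0 := by
    simp [Matrix.trace, distMatrix]
  have htrJ : J.trace = (m : ℝ) ^ 2 := by
    simp [Matrix.trace, hJ, hcard]
  have htrDD : (distMatrix G * distMatrix G).trace =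
      ((m : ℝ) - 1) * m ^ 2 + (4 * (m : ℝ) ^ 2 - 10 * m + 6) * m ^ 2 := by
    rw [hDD]
    simp [Matrix.trace_add, Matrix.trace_smul, htrD, htrJ, hcard]
  have hs1 := hD.trace_eq_sum_eigenvalues
  have hs2 := aux_trace_sq _ hD
  rw [htrD] at hs1
  rw [htrDD] at hs2
  have hd12 : (1 : ℝ) ≠ 1 - m := by intro h; linarith
  have hd13 : (1 : ℝ) ≠ m * (2 * m - 3) + 1 := by intro h; nlinarith
  have hd23 : (1 - m : ℝ) ≠ m * (2 * m - 3) + 1 := by intro h; nlinarith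
  have key : ∀ f : ℝ → ℝ, ∑ i, f (hD.eigenvalues i) =
      ((Finset.univ.filter fun i => hD.eigenvalues i = 1).card : ℝ) * f 1 +
      ((Finset.univ.filter fun i => hD.eigenvalues i = 1 - (m : ℝ)).card : ℝ) * f (1 - m) +
      ((Finset.univ.filter fun i => hD.eigenvalues i = (m : ℝ) * (2 * m - 3) + 1).card : ℝ)
        * f ((m : ℝ) * (2 * m - 3) + 1) := by
    intro f
    simp only [Finset.card_filter, Nat.cast_sum, Finset.sum_mul, ← Finset.sum_add_distrib]
    refine Finset.sum_congr rfl fun i _ => ?_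
    rcases htri i with h | h | h <;> rw [h]
    · simp [hd12, hd13]
    · rw [if_neg hd12.symm, if_pos rfl, if_neg hd23]; simp
    · rw [if_neg hd13.symm, if_neg hd23.symm, if_pos rfl]; simp
  have k0 := key fun _ => 1
  have k1 := key fun x => x
  have k2 := key fun x => x ^ 2
  simp only [RCLike.ofReal_real_eq_id, id] at hs1
  rw [← hs1] at k1
  rw [← hs2] at k2
  simp only [Finset.sum_const, Finset.card_univ, nsmul_eq_mul, mul_one, hcard] at k0
  refine ⟨htri, ?_⟩
  generalize (Finset.univ.filter fun i => hD.eigenvalues i = 1).card = a at *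
  generalize (Finset.univ.filter fun i => hD.eigenvalues i = 1 - (m : ℝ)).card = b at *
  generalize (Finset.univ.filter fun i =>
    hD.eigenvalues i = (m : ℝ) * (2 * m - 3) + 1).card = c at *
  have hcne : (m : ℝ) ^ 2 * ((2 * m - 3) * (2 * m - 2)) ≠ 0 := by
    have h1 : (0 : ℝ) < 2 * m - 3 := by linarith
    have h2 : (0 : ℝ) < 2 * m - 2 := by linarith
    positivity
  have hc : (c : ℝ) = 1 := by
    apply mul_right_cancel₀ hcne
    linear_combination -k2 + (2 - m) * k1 + (m - 1) * k0
  have hb : (b : ℝ) = 3 * m - 3 := by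
    rw [hc] at k0 k1
    apply mul_right_cancel₀ (show (m : ℝ) ≠ 0 by linarith)
    linear_combination k1 - k0
  have ha : (a : ℝ) = m ^ 2 - 3 * m + 2 := by
    rw [hc, hb] at k0
    linarith
  have hc' : c = 1 := by exact_mod_cast hc
  have hb' : b + 3 = 3 * m := by
    have : (b : ℝ) + 3 = 3 * m := by linarith
    exact_mod_cast this
  have ha' : a + 3 * m = m ^ 2 + 2 := by
    have : (a : ℝ) + 3 * m = m ^ 2 + 2 := by linarith
    exact_mod_cast this
  have hm2 : 3 * m ≤ m ^ 2 := by nlinarith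
  refine ⟨by omega, by omega, hc'⟩
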